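/- arXiv:1502.07046 — 9 statements merged into one kernel-verified Lean document; each statement's English description precedes it below -/
import Mathlib

section
/- If (Φ, E₊, E₋) is a generalized almost contact structure on W = V × V*, then Φ(E₊) = 0 and Φ(E₋) = 0; consequently ⟨E₊, Φw⟩ = 0 and ⟨E₋, Φw⟩ = 0 for every w ∈ W. -/
open Module

noncomputable section

/-- The generalized tangent space `W = V × V*` (with `V →ₗ[ℝ] ℝ` as the dual `V*`). -/
abbrev GT (V : Type*) [AddCommGroup V] [Module ℝ V] := V × (V →ₗ[ℝ] ℝ)

/-- The canonical symmetric pairing `⟨(X,α),(Y,β)⟩ = (β X + α Y)/2` on `W = V × V*` (with `V →ₗ[ℝ] ℝ` as the dual `V*`). -/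
def gpair {V : Type*} [AddCommGroup V] [Module ℝ V] (u v : GT V) : ℝ :=
  (v.2 u.1 + u.2 v.1) / 2

theorem gpair_comm {V : Type*} [AddCommGroup V] [Module ℝ V] (u v : GT V) :
    gpair u v = gpair v u := by
  simp only [gpair, add_comm]

theorem gpair_zero_right {V : Type*} [AddCommGroup V] [Module ℝ V] (u : GT V) :
    gpair u 0 = 0 := by
  simp [gpair]

/-- A skew-adjoint `Φ` with `Φ² = -1 + E ⊗ F + F ⊗ E` kills the isotropic vector `E`. -/
theorem map_eq_zero_of_isotropic {V : Type*} [AddCommGroup V] [Module ℝ V]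
    (Φ : GT V →ₗ[ℝ] GT V) (E F : GT V)
    (hskew : ∀ u v : GT V, gpair (Φ u) v = - gpair u (Φ v))
    (hsq : ∀ w : GT V, Φ (Φ w) = -w + (2 * gpair F w) • E + (2 * gpair E w) • F)
    (hE : gpair E E = 0) (hEF : 2 * gpair E F = 1) : Φ E = 0 := by
  have hΦΦ : Φ (Φ E) = 0 := by
    rw [hsq, gpair_comm F E, hEF, hE]
    simp
  have horth : gpair E (Φ E) = 0 := by
    have h := hskew E E
    rw [gpair_comm] at h
    linarith
  obtain ⟨a, ha⟩ : ∃ a : ℝ, Φ E = a • E := by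
    refine ⟨2 * gpair F (Φ E), ?_⟩
    have h := hsq (Φ E)
    rw [hΦΦ, map_zero, horth, mul_zero, zero_smul, add_zero] at h
    exact (neg_add_eq_zero.mp h.symm)
  have haa : a • a • E = 0 := by
    rw [← ha, ← map_smul, ← ha, hΦΦ]
  rcases smul_eq_zero.mp haa with h | h
  · rw [ha, h, zero_smul]
  · rw [ha, h]

/-- For a generalized almost contact structure `(Φ, E₊, E₋)` on `W = V × V*` (with `V →ₗ[ℝ] ℝ` as the dual `V*`).
`Φ E₊ = 0`, `Φ E₋ = 0`, and consequently `⟨E₊, Φ w⟩ = ⟨E₋, Φ w⟩ = 0` for all `w`. -/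
theorem stmt0 {V : Type*} [AddCommGroup V] [Module ℝ V] [FiniteDimensional ℝ V]
    (Φ : GT V →ₗ[ℝ] GT V) (Ep Em : GT V)
    (hskew : ∀ u v : GT V, gpair (Φ u) v = - gpair u (Φ v))
    (hsq : ∀ w : GT V, Φ (Φ w) = -w + (2 * gpair Em w) • Ep + (2 * gpair Ep w) • Em)
    (hpp : gpair Ep Ep = 0) (hmm : gpair Em Em = 0)
    (hpm : 2 * gpair Ep Em = 1) :
    Φ Ep = 0 ∧ Φ Em = 0 ∧
      ∀ w : GT V, gpair Ep (Φ w) = 0 ∧ gpair Em (Φ w) = 0 := by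
  have hp : Φ Ep = 0 := map_eq_zero_of_isotropic Φ Ep Em hskew hsq hpp hpm
  have hm : Φ Em = 0 :=
    map_eq_zero_of_isotropic Φ Em Ep hskew (fun w => by rw [hsq, add_right_comm]) hmm
      (by rw [gpair_comm, hpm])
  have orth_range : ∀ E w : GT V, Φ E = 0 → gpair E (Φ w) = 0 := fun E w hE => by
    rw [← neg_eq_zero, ← hskew, hE, gpair_comm, gpair_zero_right]
  exact ⟨hp, hm, fun w => ⟨orth_range Ep w hp, orth_range Em w hm⟩⟩
end
end

section
/- For a generalized almost contact structure (Φ, E₊, E₋) on W = V × V*, the complex subspaces L⁺ = ℂ·E₊ ⊕ E^{(1,0)} and L⁻ = ℂ·E₋ ⊕ E^{(1,0)} of W_ℂ are maximal isotropic: the complex-bilinear pairing vanishes identically on L⁺ and on L⁻, and each has complex dimension equal to the real dimension of V. -/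
open Module TensorProduct

noncomputable section

/-- The canonical symmetric pairing on `W = V × V*`, as a bilinear form. -/
def gpairB (V : Type*) [AddCommGroup V] [Module ℝ V] : LinearMap.BilinForm ℝ (GT V) :=
  LinearMap.mk₂ ℝ (fun u v => (v.2 u.1 + u.2 v.1) / 2)
    (fun u u' v => by simp; ring)
    (fun c u v => by simp; ring)
    (fun u v v' => by simp; ring)
    (fun c u v => by simp; ring)

/-- The complexification of the canonical pairing on `W_ℂ = ℂ ⊗ W`. -/
def gpairC (V : Type*) [AddCommGroup V] [Module ℝ V] :
    LinearMap.BilinForm ℂ (ℂ ⊗[ℝ] GT V) :=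
  LinearMap.BilinForm.baseChange ℂ (gpairB V)

/-- A totally isotropic subspace has at most half the dimension of the ambient space. -/
theorem two_mul_finrank_le_of_isotropic {K U : Type*} [Field K] [AddCommGroup U] [Module K U]
    [FiniteDimensional K U] {B : LinearMap.BilinForm K U} (hB : B.Nondegenerate)
    {L : Submodule K U} (hL : ∀ u ∈ L, ∀ v ∈ L, B u v = 0) :
    2 * finrank K L ≤ finrank K U := by
  have hle : L ≤ B.orthogonal L := fun v hv u hu => hL u hu v hv
  have h := Submodule.finrank_mono hle
  rw [LinearMap.BilinForm.finrank_orthogonal hB] at h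
  have := Submodule.finrank_le L
  omega

/-- Base change along a field extension preserves nondegeneracy of a bilinear form. -/
theorem nondegenerate_baseChange {K F W : Type*} [Field K] [Field F] [Algebra K F]
    [AddCommGroup W] [Module K W] [FiniteDimensional K W] {B : LinearMap.BilinForm K W}
    (hB : B.Nondegenerate) : (LinearMap.BilinForm.baseChange F B).Nondegenerate := by
  classical
  let b := Module.finBasis K W
  have hdet := (LinearMap.BilinForm.nondegenerate_iff_det_ne_zero b).1 hB
  rw [LinearMap.BilinForm.nondegenerate_iff_det_ne_zero (b.baseChange F)]
  have hmat : LinearMap.BilinForm.toMatrix (b.baseChange F) (LinearMap.BilinForm.baseChange F B) =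
      (algebraMap K F).mapMatrix (LinearMap.BilinForm.toMatrix b B) := by
    ext i k
    simp [LinearMap.BilinForm.toMatrix_apply, Algebra.algebraMap_eq_smul_one]
  rw [hmat, ← RingHom.map_det]
  simpa using hdet

section AlmostContact

variable {K U : Type*} [Field K] [AddCommGroup U] [Module K U]

/-- The sum of the line through `e` and the image under `1 - j Φ` of the orthogonal complement
of `{p, m}`. -/
def lineSupEigenspace (B : LinearMap.BilinForm K U) (Φ : U →ₗ[K] U) (p m e : U) (j : K) :
    Submodule K U :=
  Submodule.span K {e} ⊔ Submodule.map (LinearMap.id - j • Φ)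
    (LinearMap.ker (B p) ⊓ LinearMap.ker (B m))

variable {B : LinearMap.BilinForm K U} {Φ : U →ₗ[K] U} {p m : U}

theorem apply_eq_zero_of_almostContact
    (h2 : (2 : K) ≠ 0) (hsymm : ∀ u v, B u v = B v u)
    (hskew : ∀ u v, B (Φ u) v = -B u (Φ v))
    (hsq : ∀ w, Φ (Φ w) = -w + (2 * B m w) • p + (2 * B p w) • m)
    (hpp : B p p = 0) (hpm : 2 * B p m = 1) : Φ p = 0 := by
  have hmp : 2 * B m p = 1 := by rw [hsymm, hpm]
  have hp2 : Φ (Φ p) = 0 := by rw [hsq, hmp, hpp]; simp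
  have hself : B p (Φ p) = 0 := by
    have h := hskew p p
    rw [hsymm] at h
    have h' : 2 * B p (Φ p) = 0 := by linear_combination h
    exact (mul_eq_zero.1 h').resolve_left h2
  have h3 := hsq (Φ p)
  rw [hp2, map_zero, hself] at h3
  have h4 : Φ p = (2 * B m (Φ p)) • p := by
    have h5 : -Φ p + (2 * B m (Φ p)) • p = 0 := by simpa using h3.symm
    exact (neg_add_eq_zero.1 h5)
  generalize 2 * B m (Φ p) = a at h4
  have h5 : (a * a) • p = 0 := by
    rw [mul_smul, ← h4, ← map_smul, ← h4, hp2]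
  rcases smul_eq_zero.1 h5 with h | h
  · rw [h4, mul_self_eq_zero.1 h, zero_smul]
  · rw [h, map_zero]

theorem lineSupEigenspace_isotropic {e : U} {j : K}
    (h2 : (2 : K) ≠ 0) (hj : j * j = -1) (hsymm : ∀ u v, B u v = B v u)
    (hskew : ∀ u v, B (Φ u) v = -B u (Φ v))
    (hsq : ∀ w, Φ (Φ w) = -w + (2 * B m w) • p + (2 * B p w) • m)
    (hee : B e e = 0) (hΦe : Φ e = 0) (he : e = p ∨ e = m) :
    ∀ u ∈ lineSupEigenspace B Φ p m e j, ∀ v ∈ lineSupEigenspace B Φ p m e j, B u v = 0 := by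
  have heig : ∀ w, B p w = 0 → B m w = 0 →
      Φ (w - j • Φ w) = j • (w - j • Φ w) ∧ B e (w - j • Φ w) = 0 := by
    intro w hp hm
    constructor
    · rw [map_sub, map_smul, hsq, hp, hm, smul_sub, smul_smul, hj]
      simp [add_comm]
    · have h1 : B e w = 0 := by rcases he with rfl | rfl <;> assumption
      have h3 := hskew e w
      rw [hΦe] at h3
      simp only [map_zero, LinearMap.zero_apply] at h3
      rw [map_sub, map_smul, h1, neg_eq_zero.1 h3.symm]
      simp
  intro u hu v hv
  obtain ⟨_, hu1, _, ⟨x, ⟨hxp, hxm⟩, rfl⟩, rfl⟩ := Submodule.mem_sup.1 hu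
  obtain ⟨_, hv1, _, ⟨y, ⟨hyp, hym⟩, rfl⟩, rfl⟩ := Submodule.mem_sup.1 hv
  obtain ⟨a, rfl⟩ := Submodule.mem_span_singleton.1 hu1
  obtain ⟨b, rfl⟩ := Submodule.mem_span_singleton.1 hv1
  obtain ⟨hx1, hx2⟩ := heig x hxp hxm
  obtain ⟨hy1, hy2⟩ := heig y hyp hym
  simp only [LinearMap.sub_apply, LinearMap.id_apply, LinearMap.smul_apply]
  generalize x - j • Φ x = x' at hx1 hx2 ⊢
  generalize y - j • Φ y = y' at hy1 hy2 ⊢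
  have hxy := hskew x' y'
  rw [hx1, hy1] at hxy
  simp only [map_smul, LinearMap.smul_apply, smul_eq_mul] at hxy
  have hj0 : j ≠ 0 := by rintro rfl; simp at hj
  have hxy' : 2 * j * B x' y' = 0 := by linear_combination hxy
  have hxy0 : B x' y' = 0 := (mul_eq_zero.1 hxy').resolve_left (mul_ne_zero h2 hj0)
  have hx3 : B x' e = 0 := by rw [hsymm, hx2]
  simp [hee, hy2, hx3, hxy0]

theorem lineSupEigenspace_sup_eq_top (h2 : (2 : K) ≠ 0) (hsymm : ∀ u v, B u v = B v u)
    (hpp : B p p = 0) (hmm : B m m = 0) (hpm : 2 * B p m = 1)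
    {e f : U} (hef : e = p ∧ f = m ∨ e = m ∧ f = p) (j : K) :
    lineSupEigenspace B Φ p m e j ⊔ lineSupEigenspace B Φ p m f (-j) = ⊤ := by
  set S := lineSupEigenspace B Φ p m e j ⊔ lineSupEigenspace B Φ p m f (-j) with hS
  have he : e ∈ S := Submodule.mem_sup_left
    (Submodule.mem_sup_left (Submodule.mem_span_singleton_self e))
  have hf : f ∈ S := Submodule.mem_sup_right
    (Submodule.mem_sup_left (Submodule.mem_span_singleton_self f))
  have hp : p ∈ S := by rcases hef with ⟨rfl, rfl⟩ | ⟨rfl, rfl⟩ <;> assumption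
  have hm : m ∈ S := by rcases hef with ⟨rfl, rfl⟩ | ⟨rfl, rfl⟩ <;> assumption
  have hN : ∀ w, B p w = 0 → B m w = 0 → w ∈ S := by
    intro w hpw hmw
    have h1 : w - j • Φ w ∈ S :=
      Submodule.mem_sup_left (Submodule.mem_sup_right ⟨w, ⟨hpw, hmw⟩, rfl⟩)
    have h3 : w - (-j) • Φ w ∈ S :=
      Submodule.mem_sup_right (Submodule.mem_sup_right ⟨w, ⟨hpw, hmw⟩, rfl⟩)
    have h4 : (2 : K) • w ∈ S := by
      convert S.add_mem h1 h3 using 1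
      module
    exact (S.smul_mem_iff h2).1 h4
  have hmp : 2 * B m p = 1 := by rw [hsymm, hpm]
  refine eq_top_iff.2 fun u _ => ?_
  have hw := hN (u - ((2 * B m u) • p + (2 * B p u) • m))
    (by simp only [map_sub, map_add, map_smul, smul_eq_mul, hpp]
        linear_combination (-B p u) * hpm)
    (by simp only [map_sub, map_add, map_smul, smul_eq_mul, hmm]
        linear_combination (-B m u) * hmp)
  exact (S.sub_mem_iff_left (S.add_mem (S.smul_mem _ hp) (S.smul_mem _ hm))).1 hw

/-- The line through `p` or `m`, together with an eigenspace of `Φ`, spans a subspace of half the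
dimension of `U`. -/
theorem two_mul_finrank_lineSupEigenspace [FiniteDimensional K U] {e f : U} {j : K}
    (h2 : (2 : K) ≠ 0) (hj : j * j = -1) (hB : B.Nondegenerate) (hsymm : ∀ u v, B u v = B v u)
    (hskew : ∀ u v, B (Φ u) v = -B u (Φ v))
    (hsq : ∀ w, Φ (Φ w) = -w + (2 * B m w) • p + (2 * B p w) • m)
    (hpp : B p p = 0) (hmm : B m m = 0) (hpm : 2 * B p m = 1)
    (hΦp : Φ p = 0) (hΦm : Φ m = 0) (hef : e = p ∧ f = m ∨ e = m ∧ f = p) :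
    2 * finrank K (lineSupEigenspace B Φ p m e j) = finrank K U := by
  have hiso : ∀ {g : U} {k : K}, k * k = -1 → (g = p ∨ g = m) →
      2 * finrank K (lineSupEigenspace B Φ p m g k) ≤ finrank K U := by
    intro g k hk hg
    refine two_mul_finrank_le_of_isotropic hB
      (lineSupEigenspace_isotropic h2 hk hsymm hskew hsq ?_ ?_ hg) <;>
    rcases hg with rfl | rfl <;> assumption
  have h1 := hiso hj (g := e) (by tauto)
  have h3 := hiso (k := -j) (by rw [neg_mul_neg, hj]) (g := f) (by tauto)
  have h4 := Submodule.finrank_add_le_finrank_add_finrank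
    (lineSupEigenspace B Φ p m e j) (lineSupEigenspace B Φ p m f (-j))
  rw [lineSupEigenspace_sup_eq_top h2 hsymm hpp hmm hpm hef, finrank_top] at h4
  omega

end AlmostContact

theorem gpairB_apply {V : Type*} [AddCommGroup V] [Module ℝ V] (u v : GT V) :
    gpairB V u v = (v.2 u.1 + u.2 v.1) / 2 := rfl

theorem gpairB_comm {V : Type*} [AddCommGroup V] [Module ℝ V] (u v : GT V) :
    gpairB V u v = gpairB V v u := by
  rw [gpairB_apply, gpairB_apply, add_comm]

theorem gpairB_nondegenerate (V : Type*) [AddCommGroup V] [Module ℝ V] :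
    (gpairB V).Nondegenerate := by
  have hleft : ∀ u : GT V, (∀ v, gpairB V u v = 0) → u = 0 := by
    intro u hu
    refine Prod.ext ?_ ?_
    · refine (Module.forall_dual_apply_eq_zero_iff ℝ u.1).1 fun φ => ?_
      simpa [gpairB_apply] using hu (0, φ)
    · ext x
      simpa [gpairB_apply] using hu (x, 0)
  exact ⟨hleft, fun v hv => hleft v fun u => by rw [gpairB_comm]; exact hv u⟩

theorem gpairC_tmul {V : Type*} [AddCommGroup V] [Module ℝ V] (a b : ℂ) (u v : GT V) :
    gpairC V (a ⊗ₜ[ℝ] u) (b ⊗ₜ[ℝ] v) = gpairB V u v * (a * b) := by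
  simp [gpairC]

theorem gpairC_comm {V : Type*} [AddCommGroup V] [Module ℝ V] (u v : ℂ ⊗[ℝ] GT V) :
    gpairC V u v = gpairC V v u :=
  (LinearMap.BilinForm.IsSymm.baseChange ℂ (B₂ := gpairB V) ⟨gpairB_comm⟩).eq u v

/-- For a generalized almost contact structure `(Φ, E₊, E₋)` on `W = V × V*`,
the subspaces `L⁺ = ℂ·E₊ ⊕ E^{(1,0)}` and `L⁻ = ℂ·E₋ ⊕ E^{(1,0)}` of `W_ℂ` are maximal
isotropic: the complexified pairing vanishes identically on each, and each has complex
dimension equal to `dim_ℝ V`. -/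
theorem stmt3 {V : Type*} [AddCommGroup V] [Module ℝ V] [FiniteDimensional ℝ V]
    (Φ : GT V →ₗ[ℝ] GT V) (Ep Em : GT V)
    (hskew : ∀ u v : GT V, gpairB V (Φ u) v = - gpairB V u (Φ v))
    (hsq : ∀ w : GT V,
      Φ (Φ w) = -w + (2 * gpairB V Em w) • Ep + (2 * gpairB V Ep w) • Em)
    (hpp : gpairB V Ep Ep = 0) (hmm : gpairB V Em Em = 0)
    (hpm : 2 * gpairB V Ep Em = 1) :
    ∀ E10 : Submodule ℂ (ℂ ⊗[ℝ] GT V),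
      E10 = Submodule.map (LinearMap.id - Complex.I • Φ.baseChange ℂ)
        (LinearMap.ker (gpairC V ((1 : ℂ) ⊗ₜ[ℝ] Ep)) ⊓
          LinearMap.ker (gpairC V ((1 : ℂ) ⊗ₜ[ℝ] Em))) →
      ∀ Lp Lm : Submodule ℂ (ℂ ⊗[ℝ] GT V),
      Lp = Submodule.span ℂ {(1 : ℂ) ⊗ₜ[ℝ] Ep} ⊔ E10 →
      Lm = Submodule.span ℂ {(1 : ℂ) ⊗ₜ[ℝ] Em} ⊔ E10 →
      (∀ u ∈ Lp, ∀ v ∈ Lp, gpairC V u v = 0) ∧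
      (∀ u ∈ Lm, ∀ v ∈ Lm, gpairC V u v = 0) ∧
      Module.finrank ℂ Lp = Module.finrank ℝ V ∧
      Module.finrank ℂ Lm = Module.finrank ℝ V := by
  have hcskew : ∀ u v, gpairC V (Φ.baseChange ℂ u) v = -gpairC V u (Φ.baseChange ℂ v) := by
    intro u v
    induction u with
    | zero => simp
    | add u u' hu hu' => simp only [map_add, LinearMap.add_apply, hu, hu', neg_add]
    | tmul a x =>
      induction v with
      | zero => simp
      | add v v' hv hv' => simp only [map_add, hv, hv', neg_add]
      | tmul b y => simp [gpairC_tmul, hskew]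
  have hcsq : ∀ w, Φ.baseChange ℂ (Φ.baseChange ℂ w) =
      -w + (2 * gpairC V (1 ⊗ₜ[ℝ] Em) w) • (1 : ℂ) ⊗ₜ[ℝ] Ep
        + (2 * gpairC V (1 ⊗ₜ[ℝ] Ep) w) • (1 : ℂ) ⊗ₜ[ℝ] Em := by
    intro w
    induction w with
    | zero => simp
    | add w w' hw hw' =>
      simp only [map_add, hw, hw']
      module
    | tmul a x =>
      have hreal : ∀ (r : ℝ) (y : GT V), a ⊗ₜ[ℝ] ((2 * r) • y) =
          (2 * ((r : ℂ) * (1 * a))) • (1 : ℂ) ⊗ₜ[ℝ] y := by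
        intro r y
        rw [← TensorProduct.smul_tmul, TensorProduct.smul_tmul', Complex.real_smul, smul_eq_mul]
        congr 1
        push_cast
        ring
      rw [LinearMap.baseChange_tmul, LinearMap.baseChange_tmul, hsq, gpairC_tmul, gpairC_tmul,
        TensorProduct.tmul_add, TensorProduct.tmul_add, TensorProduct.tmul_neg, hreal, hreal]
  have hcpp : gpairC V (1 ⊗ₜ[ℝ] Ep) (1 ⊗ₜ[ℝ] Ep) = 0 := by simp [gpairC_tmul, hpp]
  have hcmm : gpairC V (1 ⊗ₜ[ℝ] Em) (1 ⊗ₜ[ℝ] Em) = 0 := by simp [gpairC_tmul, hmm]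
  have hcpm : 2 * gpairC V (1 ⊗ₜ[ℝ] Ep) (1 ⊗ₜ[ℝ] Em) = 1 := by
    rw [gpairC_tmul, one_mul, mul_one]
    exact_mod_cast hpm
  have hΦp := apply_eq_zero_of_almostContact two_ne_zero gpairC_comm hcskew hcsq hcpp hcpm
  have hΦm := apply_eq_zero_of_almostContact two_ne_zero gpairC_comm hcskew
    (fun w => by rw [hcsq, add_right_comm]) hcmm (by rw [gpairC_comm, hcpm])
  have hnd : (gpairC V).Nondegenerate := nondegenerate_baseChange (gpairB_nondegenerate V)
  have hdim : finrank ℂ (ℂ ⊗[ℝ] GT V) = 2 * finrank ℝ V := by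
    rw [Module.finrank_baseChange, Module.finrank_prod,
      show finrank ℝ (V →ₗ[ℝ] ℝ) = finrank ℝ V from Subspace.dual_finrank_eq, two_mul]
  rintro E10 rfl Lp Lm rfl rfl
  have hlp := two_mul_finrank_lineSupEigenspace two_ne_zero Complex.I_mul_I hnd gpairC_comm
    hcskew hcsq hcpp hcmm hcpm hΦp hΦm (Or.inl ⟨rfl, rfl⟩)
  have hlm := two_mul_finrank_lineSupEigenspace two_ne_zero Complex.I_mul_I hnd gpairC_comm
    hcskew hcsq hcpp hcmm hcpm hΦp hΦm (Or.inr ⟨rfl, rfl⟩)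
  rw [hdim] at hlp hlm
  exact ⟨lineSupEigenspace_isotropic two_ne_zero Complex.I_mul_I gpairC_comm hcskew hcsq hcpp
      hΦp (Or.inl rfl),
    lineSupEigenspace_isotropic two_ne_zero Complex.I_mul_I gpairC_comm hcskew hcsq hcmm
      hΦm (Or.inr rfl),
    Nat.eq_of_mul_eq_mul_left two_pos hlp, Nat.eq_of_mul_eq_mul_left two_pos hlm⟩
end
end

section
/- If (Φ, E₊, E₋) is a generalized almost contact structure on W = V × V* and G is a compatible generalized metric, then G(E₊) = E₋ and G(E₋) = E₊. -/
open Module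

noncomputable section

theorem gpair_zero_left {V : Type*} [AddCommGroup V] [Module ℝ V] (v : GT V) :
    gpair 0 v = 0 := by
  simp [gpair]

/-- In a generalized almost contact structure, `Φ` annihilates the isotropic vectors. -/
theorem map_eq_zero_of_almostContact {V : Type*} [AddCommGroup V] [Module ℝ V]
    (Φ : GT V →ₗ[ℝ] GT V) (e f : GT V)
    (hskew : ∀ u v : GT V, gpair (Φ u) v = - gpair u (Φ v))
    (hsq : ∀ w : GT V, Φ (Φ w) = -w + (2 * gpair f w) • e + (2 * gpair e w) • f)
    (hee : gpair e e = 0) (hef : 2 * gpair e f = 1) : Φ e = 0 := by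
  have hΦΦ : Φ (Φ e) = 0 := by
    rw [hsq, gpair_comm f e, hef, hee]
    simp
  have horth : gpair e (Φ e) = 0 := by
    have h := hskew e e
    rw [gpair_comm] at h
    linarith
  have hmul : Φ e = (2 * gpair f (Φ e)) • e := by
    have h := hsq (Φ e)
    rw [hΦΦ, map_zero, horth, mul_zero, zero_smul, add_zero] at h
    exact neg_add_eq_zero.mp h.symm
  have he : e ≠ 0 := by
    rintro rfl
    rw [gpair_zero_left] at hef
    norm_num at hef
  generalize 2 * gpair f (Φ e) = c at hmul
  rw [hmul, map_smul, hmul, smul_smul, smul_eq_zero, mul_self_eq_zero] at hΦΦ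
  rw [hmul, hΦΦ.resolve_right he, zero_smul]

/-- For a generalized almost contact metric structure `(Φ, E₊, E₋, G)` on
`W = V × V*`, one has `G E₊ = E₋` and `G E₋ = E₊`. -/
theorem stmt4 {V : Type*} [AddCommGroup V] [Module ℝ V] [FiniteDimensional ℝ V]
    (Φ : GT V →ₗ[ℝ] GT V) (Ep Em : GT V) (G : GT V →ₗ[ℝ] GT V)
    (hskew : ∀ u v : GT V, gpair (Φ u) v = - gpair u (Φ v))
    (hsq : ∀ w : GT V, Φ (Φ w) = -w + (2 * gpair Em w) • Ep + (2 * gpair Ep w) • Em)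
    (hpp : gpair Ep Ep = 0) (hmm : gpair Em Em = 0)
    (hpm : 2 * gpair Ep Em = 1)
    (hGsa : ∀ u v : GT V, gpair (G u) v = gpair u (G v))
    (hGsq : ∀ w : GT V, G (G w) = w)
    (hGc : ∀ w : GT V,
      -(Φ (G (Φ w))) = G w - (2 * gpair Ep w) • Ep - (2 * gpair Em w) • Em) :
    G Ep = Em ∧ G Em = Ep := by
  have hmp : 2 * gpair Em Ep = 1 := by rw [gpair_comm, hpm]
  have hp : Φ Ep = 0 := map_eq_zero_of_almostContact Φ Ep Em hskew hsq hpp hpm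
  have hm : Φ Em = 0 := map_eq_zero_of_almostContact Φ Em Ep hskew
    (fun w => by rw [hsq, add_right_comm]) hmm hmp
  constructor
  · have h := hGc Ep
    rw [hp, hpp, hmp] at h
    exact sub_eq_zero.mp (by simpa using h.symm)
  · have h := hGc Em
    rw [hm, hmm, hpm] at h
    exact sub_eq_zero.mp (by simpa using h.symm)
end
end

section
/- If (Φ, E₊, E₋) is a generalized almost contact structure on W = V × V* and G is a compatible generalized metric, then the complex-linear extension of G maps E^{(1,0)} onto E^{(1,0)}, i.e. G(E^{(1,0)}) = E^{(1,0)}. -/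
open Module TensorProduct

noncomputable section

/-- A skew-adjoint `Φ` with `Φ² = -1 + E ⊗ F + F ⊗ E` annihilates the null vector `E`. -/
theorem apply_eq_zero_of_skew {V : Type*} [AddCommGroup V] [Module ℝ V]
    (Φ : GT V →ₗ[ℝ] GT V) (E F : GT V)
    (hskew : ∀ u v : GT V, gpairB V (Φ u) v = - gpairB V u (Φ v))
    (hsq : ∀ w : GT V,
      Φ (Φ w) = -w + (2 * gpairB V F w) • E + (2 * gpairB V E w) • F)
    (hE : gpairB V E E = 0) (hEF : 2 * gpairB V E F = 1) : Φ E = 0 := by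
  have h0 : Φ (Φ E) = 0 := by
    rw [hsq, hE, gpairB_comm F E, hEF]
    simp
  have h1 : gpairB V E (Φ E) = 0 := by
    have := hskew E E
    rw [gpairB_comm] at this
    linarith
  have h2 := hsq (Φ E)
  rw [h0, h1, map_zero, mul_zero, zero_smul, add_zero, eq_comm, neg_add_eq_zero] at h2
  have h3 := congrArg Φ h2
  rw [h0, map_smul, eq_comm, smul_eq_zero] at h3
  rcases h3 with h3 | h3
  · rw [h2, h3, zero_smul]
  · exact h3

/-- If `G` exchanges `u` and `v` under the pairing, so does its complexification. -/
theorem gpairC_baseChange_apply {V : Type*} [AddCommGroup V] [Module ℝ V]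
    (G : GT V →ₗ[ℝ] GT V) (u v : GT V) (h : ∀ w, gpairB V u (G w) = gpairB V v w)
    (x : ℂ ⊗[ℝ] GT V) :
    gpairC V (1 ⊗ₜ[ℝ] u) (G.baseChange ℂ x) = gpairC V (1 ⊗ₜ[ℝ] v) x := by
  induction x with
  | zero => simp
  | tmul a w => simp [gpairC, h]
  | add x y hx hy => rw [map_add, map_add, map_add, hx, hy]

/-- For a generalized almost contact metric structure `(Φ, E₊, E₋, G)` on
`W = V × V*`, the complex-linear extension of `G` maps
`E^{(1,0)} = { w − i·Φw : ⟨E₊,w⟩ = ⟨E₋,w⟩ = 0 }` onto itself. -/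
theorem stmt6 {V : Type*} [AddCommGroup V] [Module ℝ V] [FiniteDimensional ℝ V]
    (Φ : GT V →ₗ[ℝ] GT V) (Ep Em : GT V) (G : GT V →ₗ[ℝ] GT V)
    (hskew : ∀ u v : GT V, gpairB V (Φ u) v = - gpairB V u (Φ v))
    (hsq : ∀ w : GT V,
      Φ (Φ w) = -w + (2 * gpairB V Em w) • Ep + (2 * gpairB V Ep w) • Em)
    (hpp : gpairB V Ep Ep = 0) (hmm : gpairB V Em Em = 0)
    (hpm : 2 * gpairB V Ep Em = 1)
    (hGsa : ∀ u v : GT V, gpairB V (G u) v = gpairB V u (G v))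
    (hGsq : ∀ w : GT V, G (G w) = w)
    (hGc : ∀ w : GT V,
      -(Φ (G (Φ w))) = G w - (2 * gpairB V Ep w) • Ep - (2 * gpairB V Em w) • Em) :
    ∀ E10 : Submodule ℂ (ℂ ⊗[ℝ] GT V),
      E10 = Submodule.map (LinearMap.id - Complex.I • Φ.baseChange ℂ)
        (LinearMap.ker (gpairC V ((1 : ℂ) ⊗ₜ[ℝ] Ep)) ⊓
          LinearMap.ker (gpairC V ((1 : ℂ) ⊗ₜ[ℝ] Em))) →
      Submodule.map (G.baseChange ℂ) E10 = E10 := by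
  rintro E10 rfl
  have hEp : Φ Ep = 0 := apply_eq_zero_of_skew Φ Ep Em hskew hsq hpp hpm
  have hmp : 2 * gpairB V Em Ep = 1 := by rw [gpairB_comm, hpm]
  have hEm : Φ Em = 0 :=
    apply_eq_zero_of_skew Φ Em Ep hskew (fun w => by rw [hsq]; abel) hmm hmp
  have hGEp : G Ep = Em := by
    have := hGc Ep
    rw [hEp, hpp, hmp] at this
    exact sub_eq_zero.mp (by simpa using this.symm)
  have hGEm : G Em = Ep := by rw [← hGEp, hGsq]
  have hpG (w : GT V) : gpairB V Ep (G w) = gpairB V Em w := by rw [← hGsa, hGEp]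
  have hmG (w : GT V) : gpairB V Em (G w) = gpairB V Ep w := by rw [← hGsa, hGEm]
  have hpΦ (w : GT V) : gpairB V Ep (Φ w) = 0 := by
    rw [← neg_eq_zero, ← hskew, hEp, map_zero, LinearMap.zero_apply]
  have hmΦ (w : GT V) : gpairB V Em (Φ w) = 0 := by
    rw [← neg_eq_zero, ← hskew, hEm, map_zero, LinearMap.zero_apply]
  have hcomm (w : GT V) : G (Φ w) = Φ (G w) := by
    have := congrArg Φ (hGc w)
    rw [map_neg, hsq, hpG, hmG, hpΦ, hmΦ] at this
    simpa [hEp, hEm] using this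
  have hcommC (x : ℂ ⊗[ℝ] GT V) :
      G.baseChange ℂ (Φ.baseChange ℂ x) = Φ.baseChange ℂ (G.baseChange ℂ x) := by
    induction x with
    | zero => simp
    | tmul a w => simp only [LinearMap.baseChange_tmul, hcomm]
    | add x y hx hy => simp only [map_add, hx, hy]
  have hGsqC (x : ℂ ⊗[ℝ] GT V) : G.baseChange ℂ (G.baseChange ℂ x) = x := by
    induction x with
    | zero => simp
    | tmul a w => simp only [LinearMap.baseChange_tmul, hGsq]
    | add x y hx hy => simp only [map_add, hx, hy]
  have hle : Submodule.map (G.baseChange ℂ)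
      (Submodule.map (LinearMap.id - Complex.I • Φ.baseChange ℂ)
        (LinearMap.ker (gpairC V ((1 : ℂ) ⊗ₜ[ℝ] Ep)) ⊓
          LinearMap.ker (gpairC V ((1 : ℂ) ⊗ₜ[ℝ] Em)))) ≤
      Submodule.map (LinearMap.id - Complex.I • Φ.baseChange ℂ)
        (LinearMap.ker (gpairC V ((1 : ℂ) ⊗ₜ[ℝ] Ep)) ⊓
          LinearMap.ker (gpairC V ((1 : ℂ) ⊗ₜ[ℝ] Em))) := by
    rintro _ ⟨_, ⟨x, ⟨hxp, hxm⟩, rfl⟩, rfl⟩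
    refine ⟨G.baseChange ℂ x, ⟨?_, ?_⟩, ?_⟩
    · exact (gpairC_baseChange_apply G Ep Em hpG x).trans hxm
    · exact (gpairC_baseChange_apply G Em Ep hmG x).trans hxp
    · simp only [LinearMap.sub_apply, LinearMap.id_apply, LinearMap.smul_apply, map_sub,
        map_smul, hcommC]
  refine le_antisymm hle fun y hy => ?_
  exact ⟨G.baseChange ℂ y, hle ⟨y, hy, rfl⟩, hGsqC y⟩
end
end

section
/- Let (Φ, E₊, E₋) be a generalized almost contact structure on W = V × V* with compatible generalized metric G, and let B : V → V* be a linear map whose associated bilinear form is alternating, with e^B : W → W defined by e^B(X, α) = (X, α + BX). Then (e^B ∘ Φ ∘ e^{−B}, e^B E₊, e^B E₋) is a generalized almost contact structure on W, and e^B ∘ G ∘ e^{−B} is a compatible generalized metric for it. -/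
open Module

noncomputable section

/-- The B-field transformation `e^B (X, α) = (X, α + BX)` of `W = V × V*`,
for `B : V → V*` linear. -/
def eB {V : Type*} [AddCommGroup V] [Module ℝ V] (B : V →ₗ[ℝ] (V →ₗ[ℝ] ℝ)) :
    GT V →ₗ[ℝ] GT V :=
  (LinearMap.fst ℝ V (V →ₗ[ℝ] ℝ)).prod
    (LinearMap.snd ℝ V (V →ₗ[ℝ] ℝ) + B ∘ₗ LinearMap.fst ℝ V (V →ₗ[ℝ] ℝ))

theorem eB_apply {V : Type*} [AddCommGroup V] [Module ℝ V]
    (B : V →ₗ[ℝ] (V →ₗ[ℝ] ℝ)) (u : GT V) : eB B u = (u.1, u.2 + B u.1) := rfl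

theorem eB_neg_eB {V : Type*} [AddCommGroup V] [Module ℝ V]
    (B : V →ₗ[ℝ] (V →ₗ[ℝ] ℝ)) (u : GT V) : eB (-B) (eB B u) = u := by
  simp [eB_apply]

theorem eB_eB_neg {V : Type*} [AddCommGroup V] [Module ℝ V]
    (B : V →ₗ[ℝ] (V →ₗ[ℝ] ℝ)) (u : GT V) : eB B (eB (-B) u) = u := by
  simp [eB_apply]

/-- For skew `B`, the transpose of `e^B` with respect to the pairing is `e^{-B}`. -/
theorem gpair_eB_left {V : Type*} [AddCommGroup V] [Module ℝ V]
    {B : V →ₗ[ℝ] (V →ₗ[ℝ] ℝ)} (hB : ∀ x y : V, B x y = - B y x) (u v : GT V) :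
    gpair (eB B u) v = gpair u (eB (-B) v) := by
  simp only [gpair, eB_apply, LinearMap.add_apply, LinearMap.neg_apply, hB u.1 v.1]
  ring

theorem gpair_eB_right {V : Type*} [AddCommGroup V] [Module ℝ V]
    {B : V →ₗ[ℝ] (V →ₗ[ℝ] ℝ)} (hB : ∀ x y : V, B x y = - B y x) (u v : GT V) :
    gpair u (eB B v) = gpair (eB (-B) u) v := by
  simp only [gpair, eB_apply, LinearMap.add_apply, LinearMap.neg_apply, hB u.1 v.1]
  ring

/-- The B-field transform `(e^B ∘ Φ ∘ e^{−B}, e^B E₊, e^B E₋)` of a generalized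
almost contact metric structure `(Φ, E₊, E₋, G)` is again a generalized almost contact
structure, and `e^B ∘ G ∘ e^{−B}` is a compatible generalized metric for it. -/
theorem stmt9 {V : Type*} [AddCommGroup V] [Module ℝ V] [FiniteDimensional ℝ V]
    (Φ : GT V →ₗ[ℝ] GT V) (Ep Em : GT V) (G : GT V →ₗ[ℝ] GT V)
    (hskew : ∀ u v : GT V, gpair (Φ u) v = - gpair u (Φ v))
    (hsq : ∀ w : GT V, Φ (Φ w) = -w + (2 * gpair Em w) • Ep + (2 * gpair Ep w) • Em)
    (hpp : gpair Ep Ep = 0) (hmm : gpair Em Em = 0)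
    (hpm : 2 * gpair Ep Em = 1)
    (hGsa : ∀ u v : GT V, gpair (G u) v = gpair u (G v))
    (hGsq : ∀ w : GT V, G (G w) = w)
    (hGc : ∀ w : GT V,
      -(Φ (G (Φ w))) = G w - (2 * gpair Ep w) • Ep - (2 * gpair Em w) • Em)
    (B : V →ₗ[ℝ] (V →ₗ[ℝ] ℝ))
    (halt : ∀ x y : V, B x y = - B y x) :
    ∀ Φ' G' : GT V →ₗ[ℝ] GT V, ∀ Ep' Em' : GT V,
      Φ' = eB B ∘ₗ Φ ∘ₗ eB (-B) → G' = eB B ∘ₗ G ∘ₗ eB (-B) →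
      Ep' = eB B Ep → Em' = eB B Em →
      ((∀ u v : GT V, gpair (Φ' u) v = - gpair u (Φ' v)) ∧
       (∀ w : GT V,
         Φ' (Φ' w) = -w + (2 * gpair Em' w) • Ep' + (2 * gpair Ep' w) • Em') ∧
       gpair Ep' Ep' = 0 ∧ gpair Em' Em' = 0 ∧ 2 * gpair Ep' Em' = 1) ∧
      ((∀ u v : GT V, gpair (G' u) v = gpair u (G' v)) ∧
       (∀ w : GT V, G' (G' w) = w) ∧
       (∀ w : GT V,
         -(Φ' (G' (Φ' w))) = G' w - (2 * gpair Ep' w) • Ep' - (2 * gpair Em' w) • Em')) := by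
  rintro _ _ _ _ rfl rfl rfl rfl
  refine ⟨⟨fun u v => ?_, fun w => ?_, ?_, ?_, ?_⟩, fun u v => ?_, fun w => ?_, fun w => ?_⟩
  · simp only [LinearMap.comp_apply, gpair_eB_left halt, gpair_eB_right halt, hskew]
  · simp only [LinearMap.comp_apply, eB_neg_eB, hsq, map_add, map_neg, map_smul, eB_eB_neg,
      gpair_eB_left halt]
  · rw [gpair_eB_left halt, eB_neg_eB, hpp]
  · rw [gpair_eB_left halt, eB_neg_eB, hmm]
  · rw [gpair_eB_left halt, eB_neg_eB, hpm]
  · simp only [LinearMap.comp_apply, gpair_eB_left halt, gpair_eB_right halt, hGsa]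
  · simp only [LinearMap.comp_apply, eB_neg_eB, hGsq, eB_eB_neg]
  · simp only [LinearMap.comp_apply, eB_neg_eB, ← map_neg (eB B), hGc, map_sub, map_smul,
      gpair_eB_left halt]
end
end

section
/- Let φ : V → V be linear, ξ ∈ V and η ∈ V* with η(ξ) = 1 and φ(φ(X)) = −X + η(X)·ξ for all X ∈ V. Define Φ : W → W by Φ(X, α) = (φX, −α∘φ), and set E₊ = (ξ, 0), E₋ = (0, η). Then (Φ, E₊, E₋) is a generalized almost contact structure on W = V × V*. -/
open Module

noncomputable section

/-- An (almost contact) triple `(φ, ξ, η)` with `η ξ = 1` and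
`φ² = −Id + η ⊗ ξ` induces a generalized almost contact structure
`Φ(X, α) = (φX, −α∘φ)`, `E₊ = (ξ, 0)`, `E₋ = (0, η)` on `W = V × V*`. -/
theorem stmt11 {V : Type*} [AddCommGroup V] [Module ℝ V] [FiniteDimensional ℝ V]
    (φ : V →ₗ[ℝ] V) (ξ : V) (η : V →ₗ[ℝ] ℝ)
    (hη : η ξ = 1)
    (hφ : ∀ X : V, φ (φ X) = -X + η X • ξ) :
    ∀ Φ : GT V →ₗ[ℝ] GT V, Φ = φ.prodMap (-φ.dualMap) →
    ∀ Ep Em : GT V, Ep = (ξ, 0) → Em = (0, η) →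
      (∀ u v : GT V, gpair (Φ u) v = - gpair u (Φ v)) ∧
      (∀ w : GT V,
        Φ (Φ w) = -w + (2 * gpair Em w) • Ep + (2 * gpair Ep w) • Em) ∧
      gpair Ep Ep = 0 ∧ gpair Em Em = 0 ∧ 2 * gpair Ep Em = 1 := by
  rintro _ rfl _ _ rfl rfl
  refine ⟨fun u v => ?_, fun w => ?_, ?_, ?_, ?_⟩
  · simp only [gpair, LinearMap.prodMap_apply, LinearMap.neg_apply, LinearMap.dualMap_apply]
    ring
  · refine Prod.ext ?_ (LinearMap.ext fun X => ?_)
    · simp [gpair, hφ, mul_div_cancel₀]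
    · simp [gpair, hφ, LinearMap.dualMap_apply]
      ring
  · simp [gpair]
  · simp [gpair]
  · simp [gpair, hη]
end
end

section
/- Let (V, g) be a finite-dimensional real inner product space, φ : V → V linear, ξ ∈ V, η = g(ξ, ·) ∈ V*, with η(ξ) = 1, φ(φ(X)) = −X + η(X)·ξ, and g(φX, φY) = g(X, Y) − η(X)η(Y) for all X, Y ∈ V. Let g♭ : V → V*, X ↦ g(X, ·), with inverse g♯. Define Φ(X, α) = (φX, −α∘φ), E₊ = (ξ, 0), E₋ = (0, η), and G(X, α) = (g♯α, g♭X). Then G is a compatible generalized metric for the generalized almost contact structure (Φ, E₊, E₋): G is self-adjoint for the pairing, G∘G = Id, and −Φ∘G∘Φ = G − E₊⊗E₊ − E₋⊗E₋ (equivalently, φ(g♯(α∘φ)) + (shifted to components) (g♭(φX))∘φ = g♯α + g♭X − α(ξ)·ξ − η(X)·η as an identity in V × V*). -/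
open Module

noncomputable section

/-- Let `(V, g)` be a finite-dimensional real inner product space (here `g`
is a symmetric positive-definite bilinear form with musical isomorphisms `g♭ = g` and
`g♯ = gsharp`), and let `(φ, ξ, η = g ξ)` be an almost contact metric structure:
`η ξ = 1`, `φ² = −Id + η ⊗ ξ`, `g(φX, φY) = g(X,Y) − η(X)η(Y)`. Then
`G(X, α) = (g♯α, g♭X)` is a compatible generalized metric for the generalized almost
contact structure `Φ(X,α) = (φX, −α∘φ)`, `E₊ = (ξ, 0)`, `E₋ = (0, η)`: it is
self-adjoint for the pairing, `G∘G = Id`, and `−Φ∘G∘Φ = G − E₊⊗E₊ − E₋⊗E₋`. -/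
theorem stmt12 {V : Type*} [AddCommGroup V] [Module ℝ V] [FiniteDimensional ℝ V]
    (g : V →ₗ[ℝ] V →ₗ[ℝ] ℝ)
    (hgsymm : ∀ x y : V, g x y = g y x)
    (hgpos : ∀ x : V, x ≠ 0 → 0 < g x x)
    (gsharp : (V →ₗ[ℝ] ℝ) →ₗ[ℝ] V)
    (hsharp₁ : ∀ α : V →ₗ[ℝ] ℝ, g (gsharp α) = α)
    (hsharp₂ : ∀ x : V, gsharp (g x) = x)
    (φ : V →ₗ[ℝ] V) (ξ : V)
    (hη : g ξ ξ = 1)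
    (hφ : ∀ X : V, φ (φ X) = -X + g ξ X • ξ)
    (hgφ : ∀ X Y : V, g (φ X) (φ Y) = g X Y - g ξ X * g ξ Y) :
    ∀ Φ G : GT V →ₗ[ℝ] GT V, ∀ Ep Em : GT V,
      Φ = φ.prodMap (-φ.dualMap) →
      G = (gsharp ∘ₗ LinearMap.snd ℝ V (V →ₗ[ℝ] ℝ)).prod
            (g ∘ₗ LinearMap.fst ℝ V (V →ₗ[ℝ] ℝ)) →
      Ep = (ξ, 0) → Em = (0, g ξ) →
      (∀ u v : GT V, gpair (G u) v = gpair u (G v)) ∧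
      (∀ w : GT V, G (G w) = w) ∧
      (∀ w : GT V,
        -(Φ (G (Φ w))) = G w - (2 * gpair Ep w) • Ep - (2 * gpair Em w) • Em) := by
  rintro Φ G Ep Em rfl rfl rfl rfl
  have hφξ : φ ξ = 0 := by
    by_contra h
    have := hgpos _ h
    rw [hgφ, hη] at this
    norm_num at this
  have hηφ (X : V) : g ξ (φ X) = 0 := by
    have h := hφ (φ X)
    rw [hφ X, map_add, map_neg, map_smul, hφξ, smul_zero] at h
    have h' := congrArg (g ξ) (left_eq_add.mp ((add_zero _).symm.trans h))
    simpa [hη] using h'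
  have hskew (A Y : V) : g A (φ Y) = -g (φ A) Y := by
    have h := hgφ A (φ Y)
    rw [hφ Y, map_add, map_neg, map_smul, hgsymm (φ A) ξ, hηφ, hηφ] at h
    simpa using h.symm
  have hcomp (α : V →ₗ[ℝ] ℝ) : gsharp (α ∘ₗ φ) = -φ (gsharp α) := by
    rw [← hsharp₂ (-φ (gsharp α))]
    congr 1
    ext Y
    have h := hskew (gsharp α) Y
    rw [hsharp₁] at h
    simpa using h
  refine ⟨?_, ?_, ?_⟩
  · rintro ⟨X, α⟩ ⟨Y, β⟩
    have h : β (gsharp α) = α (gsharp β) := by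
      have h := hgsymm (gsharp β) (gsharp α)
      rwa [hsharp₁, hsharp₁] at h
    change (β (gsharp α) + g X Y) / 2 = (g Y X + α (gsharp β)) / 2
    rw [h, hgsymm X Y, add_comm]
  · rintro ⟨X, α⟩
    simp [hsharp₁, hsharp₂]
  · rintro ⟨X, α⟩
    have hα : g ξ (gsharp α) = α ξ := by rw [hgsymm, hsharp₁]
    have hdual : φ.dualMap α = α ∘ₗ φ := rfl
    refine Prod.ext ?_ (LinearMap.ext fun Y => ?_)
    · simp [gpair, hdual, hcomp, hφ, hα]
      module
    · simp [gpair, hgφ, mul_div_cancel₀]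
end
end

section
/- Let (Φᵢ, E₊,ᵢ, E₋,ᵢ) be generalized almost contact structures on Wᵢ = Vᵢ × Vᵢ* with compatible generalized metrics Gᵢ (i = 1, 2), let 𝒥₁ be the induced generalized almost complex structure on W₁ × W₂ and 𝒥₂ := (G₁ × G₂)∘𝒥₁. Then the i-eigenspace of the complexification of 𝒥₂ on (W₁)_ℂ × (W₂)_ℂ equals the sum of the four subspaces E^{(1,0)}_{G₁Φ₁} × {0}, {0} × E^{(1,0)}_{G₂Φ₂}, ℂ·(E₊,₁, −i·E₊,₂), and ℂ·(E₋,₁, −i·E₋,₂), where E^{(1,0)}_{GᵢΦᵢ} = { w − i·(GᵢΦᵢ)w : w ∈ (Wᵢ)_ℂ, ⟨E₊,ᵢ, w⟩ = ⟨E₋,ᵢ, w⟩ = 0 }. -/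
open Module TensorProduct

noncomputable section

theorem gpairC_one_tmul {V : Type*} [AddCommGroup V] [Module ℝ V] (u w : GT V) (z : ℂ) :
    gpairC V ((1 : ℂ) ⊗ₜ[ℝ] u) (z ⊗ₜ[ℝ] w) = (gpairB V u w : ℂ) * z := by
  simp [gpairC]

theorem two_mul_gpairC_one_tmul {V : Type*} [AddCommGroup V] [Module ℝ V] {u w : GT V}
    (h : 2 * gpairB V u w = 1) :
    2 * gpairC V ((1 : ℂ) ⊗ₜ[ℝ] u) ((1 : ℂ) ⊗ₜ[ℝ] w) = 1 := by
  rw [gpairC_one_tmul, mul_one]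
  exact_mod_cast h

section AlmostContact

variable {V : Type*} [AddCommGroup V] [Module ℝ V] {Φ G : GT V →ₗ[ℝ] GT V} {Ep Em : GT V}

/-- The endomorphism of a generalized almost contact structure kills both sections. -/
theorem almostContact_apply_eq_zero
    (hskew : ∀ u v : GT V, gpairB V (Φ u) v = - gpairB V u (Φ v))
    (hsq : ∀ w : GT V,
      Φ (Φ w) = -w + (2 * gpairB V Em w) • Ep + (2 * gpairB V Ep w) • Em)
    (hpp : gpairB V Ep Ep = 0) (hpm : 2 * gpairB V Ep Em = 1) : Φ Ep = 0 := by
  have hmp : 2 * gpairB V Em Ep = 1 := by rw [gpairB_comm, hpm]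
  have hΦΦ : Φ (Φ Ep) = 0 := by rw [hsq, hmp, hpp]; simp
  have hp : gpairB V Ep (Φ Ep) = 0 := by
    have h := hskew Ep Ep
    rw [gpairB_comm] at h
    linarith
  have hΦ : Φ Ep = (2 * gpairB V Em (Φ Ep)) • Ep := by
    have h := hsq (Φ Ep)
    rw [hΦΦ, map_zero, hp, mul_zero, zero_smul, add_zero] at h
    exact neg_add_eq_zero.mp h.symm
  have hc : (2 * gpairB V Em (Φ Ep)) * (2 * gpairB V Em (Φ Ep)) = 0 := by
    have h1 : (2 * gpairB V Em (Φ Ep)) • Φ Ep = 0 := by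
      rw [← map_smul, ← hΦ, hΦΦ]
    have h2 := congrArg (fun x => 2 * gpairB V Em x) h1
    simp only [map_smul, smul_eq_mul, map_zero, mul_zero] at h2
    linarith
  rw [hΦ, mul_self_eq_zero.mp hc, zero_smul]

theorem almostContact_metric_apply
    (hpp : gpairB V Ep Ep = 0) (hpm : 2 * gpairB V Ep Em = 1)
    (hGc : ∀ w : GT V,
      -(Φ (G (Φ w))) = G w - (2 * gpairB V Ep w) • Ep - (2 * gpairB V Em w) • Em)
    (hΦ : Φ Ep = 0) : G Ep = Em := by
  have h := hGc Ep
  rw [hΦ, gpairB_comm Em Ep, hpp, hpm] at h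
  rw [neg_eq_zero.mpr (by simp)] at h
  simpa [sub_eq_zero] using h.symm

theorem almostContact_pair_metric_comp_eq_zero
    (hskew : ∀ u v : GT V, gpairB V (Φ u) v = - gpairB V u (Φ v))
    (hGsa : ∀ u v : GT V, gpairB V (G u) v = gpairB V u (G v))
    {E E' : GT V} (hG : G E = E') (hΦ : Φ E' = 0) (w : GT V) :
    gpairB V E (G (Φ w)) = 0 := by
  have h := hskew E' w
  rw [hΦ, map_zero, LinearMap.zero_apply] at h
  rw [← hGsa, hG]
  linarith

theorem almostContact_metric_comp_sq
    (hGsq : ∀ w : GT V, G (G w) = w)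
    (hGc : ∀ w : GT V,
      -(Φ (G (Φ w))) = G w - (2 * gpairB V Ep w) • Ep - (2 * gpairB V Em w) • Em)
    (hGp : G Ep = Em) (hGm : G Em = Ep) (w : GT V) :
    G (Φ (G (Φ w))) = -w + (2 * gpairB V Em w) • Ep + (2 * gpairB V Ep w) • Em := by
  rw [← neg_neg (Φ (G (Φ w))), hGc]
  simp only [map_neg, map_sub, map_smul, hGsq, hGp, hGm]
  abel

end AlmostContact

section Complexification

variable {V : Type*} [AddCommGroup V] [Module ℝ V] {T : GT V →ₗ[ℝ] GT V} {Ep Em : GT V}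

theorem gpairC_baseChange_eq_zero {E : GT V} (h : ∀ w, gpairB V E (T w) = 0)
    (w : ℂ ⊗[ℝ] GT V) : gpairC V ((1 : ℂ) ⊗ₜ[ℝ] E) (T.baseChange ℂ w) = 0 := by
  induction w with
  | zero => simp
  | add x y hx hy => rw [map_add, map_add, hx, hy, add_zero]
  | tmul z w => rw [LinearMap.baseChange_tmul, gpairC_one_tmul, h]; simp

theorem baseChange_sq_apply
    (h : ∀ w, T (T w) = -w + (2 * gpairB V Em w) • Ep + (2 * gpairB V Ep w) • Em)
    (w : ℂ ⊗[ℝ] GT V) :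
    T.baseChange ℂ (T.baseChange ℂ w) =
      -w + (2 * gpairC V ((1 : ℂ) ⊗ₜ[ℝ] Em) w) • ((1 : ℂ) ⊗ₜ[ℝ] Ep)
        + (2 * gpairC V ((1 : ℂ) ⊗ₜ[ℝ] Ep) w) • ((1 : ℂ) ⊗ₜ[ℝ] Em) := by
  induction w with
  | zero => simp
  | add x y hx hy =>
    simp only [map_add, hx, hy]
    module
  | tmul z w =>
    have key (r : ℝ) (E : GT V) :
        z ⊗ₜ[ℝ] ((2 * r) • E) = (2 * ((r : ℂ) * z)) • ((1 : ℂ) ⊗ₜ[ℝ] E) := by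
      rw [← TensorProduct.smul_tmul, TensorProduct.smul_tmul', smul_eq_mul, mul_one,
        Complex.real_smul]
      push_cast
      rw [mul_assoc]
    simp only [LinearMap.baseChange_tmul, h, gpairC_one_tmul, TensorProduct.tmul_add,
      TensorProduct.tmul_neg, key]

end Complexification

theorem mem_map_id_sub_I_smul {A : Type*} [AddCommGroup A] [Module ℂ A] {T : A →ₗ[ℂ] A}
    {p m : A →ₗ[ℂ] ℂ} {u : A} (hp : p u = 0) (hm : m u = 0) (hT : T u = Complex.I • u) :
    u ∈ Submodule.map (LinearMap.id - Complex.I • T) (LinearMap.ker p ⊓ LinearMap.ker m) := by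
  refine ⟨(1 / 2 : ℂ) • u, ⟨by simp [hp], by simp [hm]⟩, ?_⟩
  simp only [LinearMap.sub_apply, LinearMap.smul_apply, LinearMap.id_apply, map_smul, hT]
  match_scalars
  linear_combination (-1 / 2) * Complex.I_mul_I

/-- The eigenspace computation for a product of two complex vector spaces, in terms of
endomorphisms `Tᵢ` squaring to `-1` off the span of two vectors dual to the functionals
`2 mᵢ` and `2 pᵢ`. -/
theorem eigenspace_prod_eq {A B : Type*} [AddCommGroup A] [Module ℂ A] [AddCommGroup B]
    [Module ℂ B] {T₁ : A →ₗ[ℂ] A} {T₂ : B →ₗ[ℂ] B} {a a' : A} {b b' : B}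
    {p₁ m₁ : A →ₗ[ℂ] ℂ} {p₂ m₂ : B →ₗ[ℂ] ℂ}
    (hpa : p₁ a = 0) (hma' : m₁ a' = 0) (hpa' : 2 * p₁ a' = 1) (hma : 2 * m₁ a = 1)
    (hpb : p₂ b = 0) (hmb' : m₂ b' = 0) (hpb' : 2 * p₂ b' = 1) (hmb : 2 * m₂ b = 1)
    (hTa : T₁ a = 0) (hTa' : T₁ a' = 0) (hTb : T₂ b = 0) (hTb' : T₂ b' = 0)
    (hpT₁ : ∀ w, p₁ (T₁ w) = 0) (hmT₁ : ∀ w, m₁ (T₁ w) = 0)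
    (hpT₂ : ∀ w, p₂ (T₂ w) = 0) (hmT₂ : ∀ w, m₂ (T₂ w) = 0)
    (hT₁ : ∀ w, T₁ (T₁ w) = -w + (2 * m₁ w) • a + (2 * p₁ w) • a')
    (hT₂ : ∀ w, T₂ (T₂ w) = -w + (2 * m₂ w) • b + (2 * p₂ w) • b') (x : A) (y : B) :
    (T₁ x - (2 * p₂ y) • a' - (2 * m₂ y) • a = Complex.I • x ∧
      T₂ y + (2 * p₁ x) • b' + (2 * m₁ x) • b = Complex.I • y) ↔
    (x, y) ∈ Submodule.map (LinearMap.inl ℂ A B)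
          (Submodule.map (LinearMap.id - Complex.I • T₁) (LinearMap.ker p₁ ⊓ LinearMap.ker m₁)) ⊔
        Submodule.map (LinearMap.inr ℂ A B)
          (Submodule.map (LinearMap.id - Complex.I • T₂) (LinearMap.ker p₂ ⊓ LinearMap.ker m₂)) ⊔
        Submodule.span ℂ {(a, (-Complex.I) • b)} ⊔
        Submodule.span ℂ {(a', (-Complex.I) • b')} := by
  have hI : Complex.I * Complex.I = -1 := Complex.I_mul_I
  constructor
  · rintro ⟨hx, hy⟩
    have e1 := congrArg p₁ hx
    have e2 := congrArg m₁ hx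
    simp only [map_sub, map_smul, smul_eq_mul, hpT₁, hmT₁, hpa, hma'] at e1 e2
    have hp₂ : 2 * p₂ y = -Complex.I * (2 * p₁ x) := by
      linear_combination (-2) * e1 - (2 * p₂ y) * hpa'
    have hm₂ : 2 * m₂ y = -Complex.I * (2 * m₁ x) := by
      linear_combination (-2) * e2 - (2 * m₂ y) * hma
    set u := x - (2 * m₁ x) • a - (2 * p₁ x) • a' with hu
    set v := y - (2 * m₂ y) • b - (2 * p₂ y) • b' with hv
    have hTu : T₁ u = Complex.I • u := by
      have h : T₁ x = Complex.I • x + (2 * p₂ y) • a' + (2 * m₂ y) • a := by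
        rw [← hx]; abel
      simp only [hu, map_sub, map_smul, hTa, hTa', h, hp₂, hm₂]
      module
    have hTv : T₂ v = Complex.I • v := by
      have h : T₂ y = Complex.I • y - (2 * p₁ x) • b' - (2 * m₁ x) • b := by
        rw [← hy]; abel
      have h1 : 2 * p₁ x = Complex.I * (2 * p₂ y) := by
        linear_combination (-Complex.I) * hp₂ + (2 * p₁ x) * hI
      have h2 : 2 * m₁ x = Complex.I * (2 * m₂ y) := by
        linear_combination (-Complex.I) * hm₂ + (2 * m₁ x) * hI
      simp only [hv, map_sub, map_smul, hTb, hTb', h, h1, h2]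
      module
    refine Submodule.mem_sup.2 ⟨(u, v) + (2 * m₁ x) • (a, (-Complex.I) • b),
      Submodule.mem_sup.2 ⟨(u, v), Submodule.mem_sup.2 ⟨(u, 0), ?_, (0, v), ?_, by simp⟩,
        _, Submodule.smul_mem _ _ (Submodule.mem_span_singleton_self _), rfl⟩,
      (2 * p₁ x) • (a', (-Complex.I) • b'),
      Submodule.smul_mem _ _ (Submodule.mem_span_singleton_self _), ?_⟩
    · refine ⟨u, mem_map_id_sub_I_smul ?_ ?_ hTu, rfl⟩
      · simp only [hu, map_sub, map_smul, smul_eq_mul, hpa]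
        linear_combination (-p₁ x) * hpa'
      · simp only [hu, map_sub, map_smul, smul_eq_mul, hma']
        linear_combination (-m₁ x) * hma
    · refine ⟨v, mem_map_id_sub_I_smul ?_ ?_ hTv, rfl⟩
      · simp only [hv, map_sub, map_smul, smul_eq_mul, hpb]
        linear_combination (-p₂ y) * hpb'
      · simp only [hv, map_sub, map_smul, smul_eq_mul, hmb']
        linear_combination (-m₂ y) * hmb
    · ext1
      · simp only [hu, Prod.fst_add, Prod.smul_fst]
        abel
      · simp only [hv, hp₂, hm₂, Prod.snd_add, Prod.smul_snd]
        module
  · intro h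
    obtain ⟨q, hq, r, hr, hqr⟩ := Submodule.mem_sup.1 h
    obtain ⟨s, hs, t, ht, rfl⟩ := Submodule.mem_sup.1 hq
    obtain ⟨_, ⟨_, ⟨u, ⟨hu, hu'⟩, rfl⟩, rfl⟩, _, ⟨_, ⟨v, ⟨hv, hv'⟩, rfl⟩, rfl⟩, rfl⟩ :=
      Submodule.mem_sup.1 hs
    obtain ⟨c, rfl⟩ := Submodule.mem_span_singleton.1 ht
    obtain ⟨d, rfl⟩ := Submodule.mem_span_singleton.1 hr
    rw [SetLike.mem_coe, LinearMap.mem_ker] at hu hu' hv hv'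
    obtain ⟨rfl, rfl⟩ := Prod.ext_iff.1 hqr
    have hpa'' : p₁ a' = 1 / 2 := by linear_combination hpa' / 2
    have hma'' : m₁ a = 1 / 2 := by linear_combination hma / 2
    have hpb'' : p₂ b' = 1 / 2 := by linear_combination hpb' / 2
    have hmb'' : m₂ b = 1 / 2 := by linear_combination hmb / 2
    simp only [LinearMap.inl_apply, LinearMap.inr_apply, LinearMap.sub_apply, LinearMap.id_apply,
      LinearMap.smul_apply, Prod.fst_add, Prod.snd_add, Prod.smul_fst, Prod.smul_snd,
      Prod.fst_sub, Prod.snd_sub, map_add, map_sub, map_smul, smul_eq_mul, smul_zero, mul_zero,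
      sub_zero, add_zero, zero_add, hT₁, hT₂, hpT₁, hmT₁, hpT₂, hmT₂, hTa, hTa', hTb, hTb',
      hu, hu', hv, hv', hpa, hma', hpb, hmb', hpa'', hma'', hpb'', hmb'']
    constructor
    · match_scalars <;> first
        | ring1
        | linear_combination hI
    · match_scalars <;> first
        | ring1
        | linear_combination hI
        | linear_combination c * hI
        | linear_combination d * hI

/-- For generalized almost contact metric structures `(Φᵢ, E₊ᵢ, E₋ᵢ, Gᵢ)` on
`Wᵢ` (i = 1,2), the `i`-eigenspace of the complexification of `𝒥₂ := (G₁ × G₂)∘𝒥₁` on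
`(W₁)_ℂ × (W₂)_ℂ` equals the sum of `E^{(1,0)}_{G₁Φ₁} × {0}`, `{0} × E^{(1,0)}_{G₂Φ₂}`,
`ℂ·(E₊₁, −i·E₊₂)` and `ℂ·(E₋₁, −i·E₋₂)`. -/
theorem stmt16 {V₁ V₂ : Type*} [AddCommGroup V₁] [Module ℝ V₁] [FiniteDimensional ℝ V₁]
    [AddCommGroup V₂] [Module ℝ V₂] [FiniteDimensional ℝ V₂]
    (Φ₁ : GT V₁ →ₗ[ℝ] GT V₁) (Ep₁ Em₁ : GT V₁) (G₁ : GT V₁ →ₗ[ℝ] GT V₁)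
    (Φ₂ : GT V₂ →ₗ[ℝ] GT V₂) (Ep₂ Em₂ : GT V₂) (G₂ : GT V₂ →ₗ[ℝ] GT V₂)
    (hskew₁ : ∀ u v : GT V₁, gpairB V₁ (Φ₁ u) v = - gpairB V₁ u (Φ₁ v))
    (hsq₁ : ∀ w : GT V₁,
      Φ₁ (Φ₁ w) = -w + (2 * gpairB V₁ Em₁ w) • Ep₁ + (2 * gpairB V₁ Ep₁ w) • Em₁)
    (hpp₁ : gpairB V₁ Ep₁ Ep₁ = 0) (hmm₁ : gpairB V₁ Em₁ Em₁ = 0)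
    (hpm₁ : 2 * gpairB V₁ Ep₁ Em₁ = 1)
    (hGsa₁ : ∀ u v : GT V₁, gpairB V₁ (G₁ u) v = gpairB V₁ u (G₁ v))
    (hGsq₁ : ∀ w : GT V₁, G₁ (G₁ w) = w)
    (hGc₁ : ∀ w : GT V₁,
      -(Φ₁ (G₁ (Φ₁ w))) =
        G₁ w - (2 * gpairB V₁ Ep₁ w) • Ep₁ - (2 * gpairB V₁ Em₁ w) • Em₁)
    (hskew₂ : ∀ u v : GT V₂, gpairB V₂ (Φ₂ u) v = - gpairB V₂ u (Φ₂ v))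
    (hsq₂ : ∀ w : GT V₂,
      Φ₂ (Φ₂ w) = -w + (2 * gpairB V₂ Em₂ w) • Ep₂ + (2 * gpairB V₂ Ep₂ w) • Em₂)
    (hpp₂ : gpairB V₂ Ep₂ Ep₂ = 0) (hmm₂ : gpairB V₂ Em₂ Em₂ = 0)
    (hpm₂ : 2 * gpairB V₂ Ep₂ Em₂ = 1)
    (hGsa₂ : ∀ u v : GT V₂, gpairB V₂ (G₂ u) v = gpairB V₂ u (G₂ v))
    (hGsq₂ : ∀ w : GT V₂, G₂ (G₂ w) = w)
    (hGc₂ : ∀ w : GT V₂,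
      -(Φ₂ (G₂ (Φ₂ w))) =
        G₂ w - (2 * gpairB V₂ Ep₂ w) • Ep₂ - (2 * gpairB V₂ Em₂ w) • Em₂) :
    ∀ Ep₁c Em₁c : ℂ ⊗[ℝ] GT V₁, ∀ Ep₂c Em₂c : ℂ ⊗[ℝ] GT V₂,
      Ep₁c = (1 : ℂ) ⊗ₜ[ℝ] Ep₁ → Em₁c = (1 : ℂ) ⊗ₜ[ℝ] Em₁ →
      Ep₂c = (1 : ℂ) ⊗ₜ[ℝ] Ep₂ → Em₂c = (1 : ℂ) ⊗ₜ[ℝ] Em₂ →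
      ∀ J₂c : (ℂ ⊗[ℝ] GT V₁) × (ℂ ⊗[ℝ] GT V₂) → (ℂ ⊗[ℝ] GT V₁) × (ℂ ⊗[ℝ] GT V₂),
      (J₂c = fun p =>
        (G₁.baseChange ℂ (Φ₁.baseChange ℂ p.1
            - (2 * gpairC V₂ Ep₂c p.2) • Ep₁c - (2 * gpairC V₂ Em₂c p.2) • Em₁c),
         G₂.baseChange ℂ (Φ₂.baseChange ℂ p.2
            + (2 * gpairC V₁ Ep₁c p.1) • Ep₂c + (2 * gpairC V₁ Em₁c p.1) • Em₂c))) →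
      ∀ E10₁ : Submodule ℂ (ℂ ⊗[ℝ] GT V₁),
      E10₁ = Submodule.map
          (LinearMap.id - Complex.I • (G₁.baseChange ℂ ∘ₗ Φ₁.baseChange ℂ))
          (LinearMap.ker (gpairC V₁ Ep₁c) ⊓ LinearMap.ker (gpairC V₁ Em₁c)) →
      ∀ E10₂ : Submodule ℂ (ℂ ⊗[ℝ] GT V₂),
      E10₂ = Submodule.map
          (LinearMap.id - Complex.I • (G₂.baseChange ℂ ∘ₗ Φ₂.baseChange ℂ))
          (LinearMap.ker (gpairC V₂ Ep₂c) ⊓ LinearMap.ker (gpairC V₂ Em₂c)) →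
      {p : (ℂ ⊗[ℝ] GT V₁) × (ℂ ⊗[ℝ] GT V₂) | J₂c p = Complex.I • p} =
        ↑(Submodule.map (LinearMap.inl ℂ (ℂ ⊗[ℝ] GT V₁) (ℂ ⊗[ℝ] GT V₂)) E10₁ ⊔
          Submodule.map (LinearMap.inr ℂ (ℂ ⊗[ℝ] GT V₁) (ℂ ⊗[ℝ] GT V₂)) E10₂ ⊔
          Submodule.span ℂ {(Ep₁c, (-Complex.I) • Ep₂c)} ⊔
          Submodule.span ℂ {(Em₁c, (-Complex.I) • Em₂c)}) := by
  rintro _ _ _ _ rfl rfl rfl rfl _ rfl _ rfl _ rfl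
  have hmp₁ : 2 * gpairB V₁ Em₁ Ep₁ = 1 := by rw [gpairB_comm, hpm₁]
  have hmp₂ : 2 * gpairB V₂ Em₂ Ep₂ = 1 := by rw [gpairB_comm, hpm₂]
  have hΦp₁ : Φ₁ Ep₁ = 0 := almostContact_apply_eq_zero hskew₁ hsq₁ hpp₁ hpm₁
  have hΦm₁ : Φ₁ Em₁ = 0 := almostContact_apply_eq_zero hskew₁
    (fun w => (hsq₁ w).trans (add_right_comm _ _ _)) hmm₁ hmp₁
  have hGp₁ : G₁ Ep₁ = Em₁ := almostContact_metric_apply hpp₁ hpm₁ hGc₁ hΦp₁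
  have hGm₁ : G₁ Em₁ = Ep₁ := by rw [← hGp₁, hGsq₁]
  have hTp₁ := gpairC_baseChange_eq_zero (T := G₁ ∘ₗ Φ₁)
    (almostContact_pair_metric_comp_eq_zero hskew₁ hGsa₁ hGp₁ hΦm₁)
  have hTm₁ := gpairC_baseChange_eq_zero (T := G₁ ∘ₗ Φ₁)
    (almostContact_pair_metric_comp_eq_zero hskew₁ hGsa₁ hGm₁ hΦp₁)
  have hTsq₁ := baseChange_sq_apply (T := G₁ ∘ₗ Φ₁)
    (almostContact_metric_comp_sq hGsq₁ hGc₁ hGp₁ hGm₁)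
  have hΦp₂ : Φ₂ Ep₂ = 0 := almostContact_apply_eq_zero hskew₂ hsq₂ hpp₂ hpm₂
  have hΦm₂ : Φ₂ Em₂ = 0 := almostContact_apply_eq_zero hskew₂
    (fun w => (hsq₂ w).trans (add_right_comm _ _ _)) hmm₂ hmp₂
  have hGp₂ : G₂ Ep₂ = Em₂ := almostContact_metric_apply hpp₂ hpm₂ hGc₂ hΦp₂
  have hGm₂ : G₂ Em₂ = Ep₂ := by rw [← hGp₂, hGsq₂]
  have hTp₂ := gpairC_baseChange_eq_zero (T := G₂ ∘ₗ Φ₂)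
    (almostContact_pair_metric_comp_eq_zero hskew₂ hGsa₂ hGp₂ hΦm₂)
  have hTm₂ := gpairC_baseChange_eq_zero (T := G₂ ∘ₗ Φ₂)
    (almostContact_pair_metric_comp_eq_zero hskew₂ hGsa₂ hGm₂ hΦp₂)
  have hTsq₂ := baseChange_sq_apply (T := G₂ ∘ₗ Φ₂)
    (almostContact_metric_comp_sq hGsq₂ hGc₂ hGp₂ hGm₂)
  ext ⟨x, y⟩
  rw [SetLike.mem_coe, ← LinearMap.baseChange_comp, ← LinearMap.baseChange_comp,
    ← eigenspace_prod_eq (by simp [gpairC_one_tmul, hpp₁]) (by simp [gpairC_one_tmul, hmm₁])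
      (two_mul_gpairC_one_tmul hpm₁) (two_mul_gpairC_one_tmul hmp₁)
      (by simp [gpairC_one_tmul, hpp₂]) (by simp [gpairC_one_tmul, hmm₂])
      (two_mul_gpairC_one_tmul hpm₂) (two_mul_gpairC_one_tmul hmp₂)
      (by simp [hΦp₁]) (by simp [hΦm₁]) (by simp [hΦp₂]) (by simp [hΦm₂])
      hTp₁ hTm₁ hTp₂ hTm₂ hTsq₁ hTsq₂]
  simp [Prod.ext_iff, LinearMap.baseChange_comp, hGp₁, hGm₁, hGp₂, hGm₂]
end
end

section
/- For i = 1, 2, let Vᵢ be a real vector space, φᵢ : Vᵢ → Vᵢ linear, ξᵢ ∈ Vᵢ and ηᵢ ∈ Vᵢ* with ηᵢ(ξᵢ) = 1 and φᵢ(φᵢ(X)) = −X + ηᵢ(X)·ξᵢ for all X ∈ Vᵢ. Define J : V₁ × V₂ → V₁ × V₂ by J(X, Y) = (φ₁X − η₂(Y)·ξ₁, φ₂Y + η₁(X)·ξ₂). Then J∘J = −Id, i.e. J is an almost complex structure on V₁ × V₂. -/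
/-- The characteristic vector of an almost contact structure is killed by `φ`. -/
theorem almostContact_apply_xi {V : Type*} [AddCommGroup V] [Module ℝ V]
    {φ : V →ₗ[ℝ] V} {ξ : V} {η : V →ₗ[ℝ] ℝ}
    (hη : η ξ = 1) (hφ : ∀ X : V, φ (φ X) = -X + η X • ξ) : φ ξ = 0 := by
  have hφφ : φ (φ ξ) = 0 := by simp [hφ, hη]
  have hmul : φ ξ = η (φ ξ) • ξ := by
    have h := hφ (φ ξ)
    rw [hφφ, map_zero] at h
    exact (neg_add_eq_zero.mp h.symm)
  have hsq : η (φ ξ) * η (φ ξ) = 0 := by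
    have h := congrArg η (congrArg φ hmul)
    rw [hφφ] at h
    simpa using h.symm
  rw [hmul, mul_self_eq_zero.mp hsq, zero_smul]

/-- The contact form of an almost contact structure vanishes on the range of `φ`. -/
theorem almostContact_eta_apply {V : Type*} [AddCommGroup V] [Module ℝ V]
    {φ : V →ₗ[ℝ] V} {ξ : V} {η : V →ₗ[ℝ] ℝ}
    (hη : η ξ = 1) (hφ : ∀ X : V, φ (φ X) = -X + η X • ξ) (X : V) : η (φ X) = 0 := by
  have h := hφ (φ X)
  rw [hφ X, map_add, map_neg, map_smul, almostContact_apply_xi hη hφ, smul_zero] at h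
  simpa [hη] using congrArg η (add_left_cancel h).symm

/-- Given almost-contact-type data `(φᵢ, ξᵢ, ηᵢ)` on real vector spaces `Vᵢ`
(`ηᵢ ξᵢ = 1`, `φᵢ² = −Id + ηᵢ ⊗ ξᵢ`), Morimoto's map
`J(X, Y) = (φ₁X − η₂(Y)·ξ₁, φ₂Y + η₁(X)·ξ₂)` satisfies `J∘J = −Id`,
i.e. `J` is an almost complex structure on `V₁ × V₂`. -/
theorem stmt17 {V₁ V₂ : Type*} [AddCommGroup V₁] [Module ℝ V₁]
    [AddCommGroup V₂] [Module ℝ V₂]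
    (φ₁ : V₁ →ₗ[ℝ] V₁) (ξ₁ : V₁) (η₁ : V₁ →ₗ[ℝ] ℝ)
    (φ₂ : V₂ →ₗ[ℝ] V₂) (ξ₂ : V₂) (η₂ : V₂ →ₗ[ℝ] ℝ)
    (hη₁ : η₁ ξ₁ = 1) (hφ₁ : ∀ X : V₁, φ₁ (φ₁ X) = -X + η₁ X • ξ₁)
    (hη₂ : η₂ ξ₂ = 1) (hφ₂ : ∀ Y : V₂, φ₂ (φ₂ Y) = -Y + η₂ Y • ξ₂) :
    ∀ J : V₁ × V₂ → V₁ × V₂,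
      (J = fun p => (φ₁ p.1 - η₂ p.2 • ξ₁, φ₂ p.2 + η₁ p.1 • ξ₂)) →
      ∀ p : V₁ × V₂, J (J p) = -p := by
  rintro J rfl ⟨X, Y⟩
  ext
  · simp [hφ₁, hη₂, almostContact_apply_xi hη₁ hφ₁, almostContact_eta_apply hη₂ hφ₂]
  · simp [hφ₂, hη₁, almostContact_apply_xi hη₂ hφ₂, almostContact_eta_apply hη₁ hφ₁]
end
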